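/- Let a, b, c, r be integers with a, b, c, r ≥ 1, let q be a prime power with r(a+b) + b + c ≤ q − 2, and let P be the pentagon P = conv{(0,0),(r(a+b)+b+c, 0),(b+c, a+b),(b, a+b),(0,a)}. Then d(C_P(𝔽_q)) = (q−1)² − (r(a+b) + b + c)(q−1). -/

import Mathlib

open Pointwise

/-- Embed a lattice point of `ℤ²` into `ℝ²`. -/
def toR2 (m : ℤ × ℤ) : ℝ × ℝ := ((m.1 : ℝ), (m.2 : ℝ))

/-- An integral convex polygon: the convex hull of a finite nonempty set of lattice points. -/
def IsIntPolygon (P : Set (ℝ × ℝ)) : Prop :=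
  ∃ V : Finset (ℤ × ℤ), V.Nonempty ∧ P = convexHull ℝ (toR2 '' ↑V)

/-- The lattice points of a subset of `ℝ²`. -/
def latticePts (P : Set (ℝ × ℝ)) : Set (ℤ × ℤ) := {m | toR2 m ∈ P}

/-- `I(P)`: the number of lattice points in the interior of `P`. -/
noncomputable def intPts (P : Set (ℝ × ℝ)) : ℕ := (latticePts (interior P)).ncard

/-- `#(P)`: the number of lattice points of `P`. -/
noncomputable def numPts (P : Set (ℝ × ℝ)) : ℕ := (latticePts P).ncard

/-- The lattice points of the square `□_{q-1} = [0, q-2] × [0, q-2]`. -/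
def box (q : ℕ) : Set (ℤ × ℤ) :=
  {m | 0 ≤ m.1 ∧ m.1 ≤ (q : ℤ) - 2 ∧ 0 ≤ m.2 ∧ m.2 ≤ (q : ℤ) - 2}

/-- The evaluation vector of the monomial `x^{m₁} y^{m₂}` at all points of the torus `(F*)²`. -/
def evalVec (F : Type) [Field F] (m : ℤ × ℤ) : Fˣ × Fˣ → F :=
  fun p => ((p.1 ^ m.1 * p.2 ^ m.2 : Fˣ) : F)

/-- The toric code associated to a set `S ⊆ ℤ²` of exponent vectors: the span of the
evaluation vectors of the corresponding monomials. -/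
noncomputable def toricCode (F : Type) [Field F] (S : Set (ℤ × ℤ)) :
    Submodule F (Fˣ × Fˣ → F) :=
  Submodule.span F (evalVec F '' S)

/-- Hamming weight of a word indexed by the torus `(F*)²`. -/
noncomputable def wt {F : Type} [Field F] (c : Fˣ × Fˣ → F) : ℕ :=
  {p | c p ≠ 0}.ncard

/-- Minimum distance of a linear code: minimum Hamming weight of a nonzero codeword. -/
noncomputable def minDist (F : Type) [Field F] (C : Submodule F (Fˣ × Fˣ → F)) : ℕ :=
  sInf {w | ∃ c ∈ C, c ≠ 0 ∧ wt c = w}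

/-- The support of a bivariate polynomial, as a set of lattice points. -/
def suppZ {K : Type} [CommSemiring K] (f : MvPolynomial (Fin 2) K) : Set (ℤ × ℤ) :=
  (fun d : Fin 2 →₀ ℕ => ((d 0 : ℤ), (d 1 : ℤ))) '' ↑f.support

/-- The Newton polygon of a bivariate polynomial. -/
noncomputable def NP {K : Type} [CommSemiring K] (f : MvPolynomial (Fin 2) K) :
    Set (ℝ × ℝ) :=
  convexHull ℝ (toR2 '' suppZ f)

/-- Evaluate a bivariate polynomial at a point of the torus `(F*)²`. -/
noncomputable def evalT {F : Type} [Field F] (f : MvPolynomial (Fin 2) F) (p : Fˣ × Fˣ) : F :=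
  MvPolynomial.eval ![(p.1 : F), (p.2 : F)] f

/-- The number of points of the torus `(F*)²` at which `f` vanishes. -/
noncomputable def nzeros {F : Type} [Field F] (f : MvPolynomial (Fin 2) F) : ℕ :=
  {p : Fˣ × Fˣ | evalT f p = 0}.ncard

theorem exists_evalT_eq_of_mem_toricCode {F : Type} [Field F] {S : Set (ℤ × ℤ)} {N : ℕ}
    (hS : ∀ m ∈ S, 0 ≤ m.1 ∧ 0 ≤ m.2 ∧ m.1 + m.2 ≤ N) {w : Fˣ × Fˣ → F}
    (hw : w ∈ toricCode F S) :
    ∃ f : MvPolynomial (Fin 2) F, f.totalDegree ≤ N ∧ ∀ p, evalT f p = w p := by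
  induction hw using Submodule.span_induction with
  | mem x hx =>
    obtain ⟨⟨m, n⟩, hm, rfl⟩ := hx
    obtain ⟨hm0, hn0, hmn⟩ := hS _ hm
    lift m to ℕ using hm0
    lift n to ℕ using hn0
    refine ⟨MvPolynomial.X 0 ^ m * MvPolynomial.X 1 ^ n, ?_, fun p => ?_⟩
    · refine (MvPolynomial.totalDegree_mul _ _).trans ?_
      rw [MvPolynomial.totalDegree_X_pow, MvPolynomial.totalDegree_X_pow]
      dsimp only at hmn
      exact_mod_cast hmn
    · simp [evalT, evalVec]
  | zero => exact ⟨0, by simp, fun p => by simp [evalT]⟩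
  | add x y _ _ hx hy =>
    obtain ⟨f, hf, hfx⟩ := hx
    obtain ⟨g, hg, hgy⟩ := hy
    refine ⟨f + g, (MvPolynomial.totalDegree_add f g).trans (max_le hf hg), fun p => ?_⟩
    rw [Pi.add_apply, ← hfx, ← hgy]
    exact map_add _ f g
  | smul k x _ hx =>
    obtain ⟨f, hf, hfx⟩ := hx
    refine ⟨k • f, (MvPolynomial.totalDegree_smul_le k f).trans hf, fun p => ?_⟩
    rw [Pi.smul_apply, ← hfx]
    exact MvPolynomial.smul_eval _ f k

/-- The Schwartz–Zippel bound on the torus `(F*)²`. -/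
theorem nzeros_le {F : Type} [Field F] [Fintype F] {f : MvPolynomial (Fin 2) F} (hf : f ≠ 0) :
    nzeros f ≤ f.totalDegree * Nat.card Fˣ := by
  classical
  let s : Finset F := Finset.univ.map ⟨((↑) : Fˣ → F), Units.val_injective⟩
  have hs : s.card = Nat.card Fˣ := by simp [s]
  have hpos : 0 < Nat.card Fˣ := Nat.card_pos
  let Z : Finset (Fin 2 → F) := {x ∈ Fintype.piFinset fun _ => s | MvPolynomial.eval x f = 0}
  have hZ : nzeros f ≤ Z.card := by
    rw [← Set.ncard_coe_finset]
    refine Set.ncard_le_ncard_of_injOn (fun p => ![(p.1 : F), (p.2 : F)]) ?_ ?_ (Set.toFinite _)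
    · intro p hp
      have : MvPolynomial.eval ![(p.1 : F), (p.2 : F)] f = 0 := hp
      simp [Z, s, this, Fin.forall_fin_two]
    · rintro ⟨x, y⟩ - ⟨x', y'⟩ - h
      have h0 := congrFun h 0
      have h1 := congrFun h 1
      simp only [Matrix.cons_val_zero, Matrix.cons_val_one] at h0 h1
      exact Prod.ext (Units.ext h0) (Units.ext h1)
  have key := MvPolynomial.schwartz_zippel_totalDegree hf s
  rw [hs, div_le_div_iff₀ (by positivity) (by positivity)] at key
  have key' : Z.card * Nat.card Fˣ ≤ f.totalDegree * Nat.card Fˣ ^ 2 := by exact_mod_cast key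
  refine hZ.trans (Nat.le_of_mul_le_mul_right (key'.trans_eq ?_) hpos)
  ring

theorem eval_fst_mem_toricCode {F : Type} [Field F] {S : Set (ℤ × ℤ)} {N : ℕ}
    (hS : ∀ i : ℕ, i ≤ N → ((i : ℤ), (0 : ℤ)) ∈ S) {g : Polynomial F} (hg : g.natDegree ≤ N) :
    (fun p : Fˣ × Fˣ => g.eval (p.1 : F)) ∈ toricCode F S := by
  have : (fun p : Fˣ × Fˣ => g.eval (p.1 : F)) =
      ∑ i ∈ Finset.range (N + 1), g.coeff i • evalVec F ((i : ℤ), (0 : ℤ)) := by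
    funext p
    simp [Polynomial.eval_eq_sum_range' (Nat.lt_succ_of_le hg), evalVec]
  rw [this]
  exact Submodule.sum_mem _ fun i hi => Submodule.smul_mem _ _ <| Submodule.subset_span
    ⟨_, hS i (Nat.le_of_lt_succ (Finset.mem_range.1 hi)), rfl⟩

/-- A set of exponents in the triangle `x, y ≥ 0`, `x + y ≤ N` that contains the bottom edge of
the triangle has a toric code of minimum distance `(q - 1 - N) (q - 1)`. -/
theorem minDist_toricCode_of_subset_triangle {F : Type} [Field F] [Fintype F]
    {S : Set (ℤ × ℤ)} {N : ℕ} (hS : ∀ m ∈ S, 0 ≤ m.1 ∧ 0 ≤ m.2 ∧ m.1 + m.2 ≤ N)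
    (hS' : ∀ i : ℕ, i ≤ N → ((i : ℤ), (0 : ℤ)) ∈ S) (hN : N < Nat.card Fˣ) :
    minDist F (toricCode F S) = (Nat.card Fˣ - N) * Nat.card Fˣ := by
  classical
  have hmem : (Nat.card Fˣ - N) * Nat.card Fˣ ∈
      {w | ∃ c ∈ toricCode F S, c ≠ 0 ∧ wt c = w} := by
    obtain ⟨A, -, hA⟩ := Finset.exists_subset_card_eq
      (s := (Finset.univ : Finset Fˣ)) (n := N) (by simpa using hN.le)
    let g : Polynomial F := ∏ α ∈ A, (Polynomial.X - Polynomial.C (α : F))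
    have hg : g.natDegree ≤ N := by
      rw [Polynomial.natDegree_prod_of_monic _ _ fun α _ => Polynomial.monic_X_sub_C _]
      simp [hA]
    have hwt : wt (fun p : Fˣ × Fˣ => g.eval (p.1 : F)) =
        (Nat.card Fˣ - N) * Nat.card Fˣ := by
      have : {p : Fˣ × Fˣ | g.eval (p.1 : F) ≠ 0} =
          ((Aᶜ ×ˢ Finset.univ : Finset (Fˣ × Fˣ)) : Set (Fˣ × Fˣ)) := by
        ext ⟨x, y⟩
        simp only [g, Polynomial.eval_prod, Polynomial.eval_sub, Polynomial.eval_X,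
          Polynomial.eval_C, ne_eq, Finset.prod_eq_zero_iff, sub_eq_zero, Units.val_inj,
          Set.mem_ofPred_eq, Finset.coe_product, Set.mem_prod, Finset.mem_coe, Finset.mem_compl,
          Finset.mem_univ, and_true]
        simp
      rw [wt, this, Set.ncard_coe_finset, Finset.card_product, Finset.card_compl, hA,
        Finset.card_univ, Nat.card_eq_fintype_card]
    refine ⟨_, eval_fst_mem_toricCode hS' hg, fun h => ?_, hwt⟩
    have h0 : wt (0 : Fˣ × Fˣ → F) = 0 := by simp [wt]
    have hpos : 0 < (Nat.card Fˣ - N) * Nat.card Fˣ := Nat.mul_pos (by omega) (by omega)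
    rw [h, h0] at hwt
    omega
  refine le_antisymm (Nat.sInf_le hmem) (le_csInf ⟨_, hmem⟩ ?_)
  rintro _ ⟨w, hw, hw0, rfl⟩
  obtain ⟨f, hf, hfw⟩ := exists_evalT_eq_of_mem_toricCode hS hw
  have hf0 : f ≠ 0 := by
    rintro rfl
    exact hw0 (funext fun p => by simp [← hfw, evalT])
  have hz : nzeros f ≤ N * Nat.card Fˣ := (nzeros_le hf0).trans (Nat.mul_le_mul_right _ hf)
  have hadd : nzeros f + wt w = Nat.card Fˣ * Nat.card Fˣ := by
    have hc : {p | w p ≠ 0} = {p : Fˣ × Fˣ | evalT f p = 0}ᶜ := by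
      ext p
      simp [hfw]
    rw [nzeros, wt, hc, Set.ncard_add_ncard_compl, Nat.card_prod]
  rw [Nat.sub_mul]
  omega

/-- Theorem 4.1, case I: the minimum distance of the toric code of the pentagon
`conv{(0,0), (r(a+b)+b+c, 0), (b+c, a+b), (b, a+b), (0,a)}`. -/
theorem pentagon_minDist (q : ℕ) (F : Type) [Field F] [Fintype F]
    (hF : Fintype.card F = q)
    (a b c r : ℕ) (ha : 1 ≤ a) (hb : 1 ≤ b) (hc : 1 ≤ c) (hr : 1 ≤ r)
    (hq : r * (a + b) + b + c + 2 ≤ q)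
    (P : Set (ℝ × ℝ))
    (hP : P = convexHull ℝ
      {((0 : ℝ), (0 : ℝ)), (((r * (a + b) + b + c : ℕ) : ℝ), (0 : ℝ)),
        (((b + c : ℕ) : ℝ), ((a + b : ℕ) : ℝ)),
        ((b : ℝ), ((a + b : ℕ) : ℝ)), ((0 : ℝ), (a : ℝ))}) :
    (minDist F (toricCode F (latticePts P)) : ℤ) =
      ((q : ℤ) - 1) ^ 2 - (r * (a + b) + b + c) * ((q : ℤ) - 1) := by

  have htri : ∀ x ∈ P, 0 ≤ x.1 ∧ 0 ≤ x.2 ∧ x.1 + x.2 ≤ ((r * (a + b) + b + c : ℕ) : ℝ) := by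
    have hconv : Convex ℝ {x : ℝ × ℝ | 0 ≤ x.1 ∧ 0 ≤ x.2 ∧
        x.1 + x.2 ≤ ((r * (a + b) + b + c : ℕ) : ℝ)} :=
      ((convex_halfSpace_ge (LinearMap.fst ℝ ℝ ℝ).isLinear 0).inter
        ((convex_halfSpace_ge (LinearMap.snd ℝ ℝ ℝ).isLinear 0).inter
          (convex_halfSpace_le (LinearMap.fst ℝ ℝ ℝ + LinearMap.snd ℝ ℝ ℝ).isLinear _)))
    have hab : a + b ≤ r * (a + b) := Nat.le_mul_of_pos_left _ hr
    have hab' : (a + b : ℝ) ≤ r * (a + b) := by exact_mod_cast hab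
    rw [hP]
    refine convexHull_min ?_ hconv
    rintro x (rfl | rfl | rfl | rfl | rfl) <;>
      refine ⟨by positivity, by positivity, ?_⟩ <;> push_cast <;> nlinarith
  have hbot : ∀ i : ℕ, i ≤ r * (a + b) + b + c → ((i : ℤ), (0 : ℤ)) ∈ latticePts P := by
    intro i hi
    have hpos : (0 : ℝ) < ((r * (a + b) + b + c : ℕ) : ℝ) := by
      exact_mod_cast (by omega : 0 < r * (a + b) + b + c)
    have hi' : (i : ℝ) ≤ ((r * (a + b) + b + c : ℕ) : ℝ) := by exact_mod_cast hi
    rw [hP]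
    refine segment_subset_convexHull (x := ((0 : ℝ), (0 : ℝ)))
      (y := (((r * (a + b) + b + c : ℕ) : ℝ), (0 : ℝ))) (by simp) (by simp) ?_
    refine ⟨1 - i / ((r * (a + b) + b + c : ℕ) : ℝ), i / ((r * (a + b) + b + c : ℕ) : ℝ),
      sub_nonneg.2 ((div_le_one hpos).2 hi'), by positivity, by ring, ?_⟩
    ext
    · simpa [toR2] using div_mul_cancel₀ (i : ℝ) hpos.ne'
    · simp [toR2]
  have hcard : Nat.card Fˣ + 1 = q := by
    rw [Nat.card_units, Nat.card_eq_fintype_card, hF]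
    omega
  have hlt : r * (a + b) + b + c < Nat.card Fˣ := by omega
  rw [minDist_toricCode_of_subset_triangle (N := r * (a + b) + b + c)
    (fun m hm => by
      have hm' := htri _ hm
      simp only [toR2] at hm'
      exact_mod_cast hm') hbot hlt, ← hcard]
  push_cast [Nat.cast_sub hlt.le]
  ring
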